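/- For every θ ∈ ℂ with Re θ > 0 and every j ∈ ℕ, ∫₀^∞ e^{−θt} · b^{j+1} ∑_{k=0}^j C(j,k) (a/b)^k [ P(k, λt) + (μ/λ + a/b) P(k+1, λt) ] dt = (1/θ) · ((bθ+bμ+λ)/(θ+λ)) · ((bθ+λ)/(θ+λ))^j. -/

import Mathlib

open MeasureTheory

/-- The lower regularized incomplete gamma function:
`P(k,x) = (1/(k−1)!) ∫₀^x e^{−u} u^{k−1} du` for `k ≥ 1`, and `P(0,x) = 1`. -/
noncomputable def lowP (k : ℕ) (x : ℝ) : ℝ :=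
  if k = 0 then 1
  else (1 / (Nat.factorial (k - 1) : ℝ)) * ∫ u in (0:ℝ)..x, Real.exp (-u) * u ^ (k - 1)

/-- Consecutive regularized incomplete gamma functions differ by a Poisson weight. -/
theorem lowP_succ (k : ℕ) (x : ℝ) :
    lowP (k + 1) x = lowP k x - Real.exp (-x) * x ^ k / (k.factorial : ℝ) := by
  have hexp (u : ℝ) : HasDerivAt (fun u : ℝ => Real.exp (-u)) (-Real.exp (-u)) u := by
    simpa using (hasDerivAt_neg u).exp
  have hint (n : ℕ) : IntervalIntegrable (fun u : ℝ => Real.exp (-u) * u ^ n) volume 0 x :=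
    (by fun_prop : Continuous fun u : ℝ => Real.exp (-u) * u ^ n).intervalIntegrable _ _
  rcases k with _ | n
  · have h := intervalIntegral.integral_eq_sub_of_hasDerivAt
      (f := fun u => -Real.exp (-u)) (f' := fun u => Real.exp (-u) * u ^ 0)
      (a := 0) (b := x) (fun u _ => by simpa using! (hexp u).neg) (hint 0)
    simp only [lowP, zero_add, one_ne_zero, if_false, Nat.sub_self, if_true, h]
    simp
    ring
  · have h := intervalIntegral.integral_eq_sub_of_hasDerivAt
      (f := fun u => -(Real.exp (-u) * u ^ (n + 1)))
      (f' := fun u => Real.exp (-u) * u ^ (n + 1) - (n + 1) * (Real.exp (-u) * u ^ n))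
      (a := 0) (b := x)
      (fun u _ => by
        convert! ((hexp u).mul (hasDerivAt_pow (n + 1) u)).neg using 1
        simp
        ring)
      ((hint (n + 1)).sub ((hint n).const_mul _))
    rw [intervalIntegral.integral_sub (hint (n + 1)) ((hint n).const_mul _),
      intervalIntegral.integral_const_mul] at h
    simp only [lowP, Nat.succ_ne_zero, if_false, Nat.add_sub_cancel]
    rw [sub_eq_iff_eq_add.mp h, Nat.factorial_succ]
    have h1 : (n.factorial : ℝ) ≠ 0 := by positivity
    have h2 : (n : ℝ) + 1 ≠ 0 := by positivity
    push_cast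
    field_simp
    simp
    ring

/-- The function `t ^ k * exp (-(s * t))` is integrable on the half-line if `0 < s.re`. -/
theorem integrableOn_pow_mul_exp_neg_mul_complex (k : ℕ) {s : ℂ} (hs : 0 < s.re) :
    IntegrableOn (fun t : ℝ => (t : ℂ) ^ k * Complex.exp (-(s * t))) (Set.Ioi 0) := by
  have key := Real.integral_rpow_mul_exp_neg_mul_Ioi (a := k + 1) (by positivity) hs
  have hreal : IntegrableOn (fun t : ℝ => t ^ ((k + 1 : ℝ) - 1) * Real.exp (-(s.re * t)))
      (Set.Ioi 0) := by
    refine Integrable.of_integral_ne_zero ?_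
    rw [key]
    have := Real.Gamma_pos_of_pos (s := (k : ℝ) + 1) (by positivity)
    positivity
  refine hreal.mono' ((by fun_prop : Continuous fun t : ℝ =>
    (t : ℂ) ^ k * Complex.exp (-(s * t))).aestronglyMeasurable) ?_
  filter_upwards [ae_restrict_mem measurableSet_Ioi] with t ht
  rw [norm_mul, norm_pow, Complex.norm_real, Complex.norm_exp, Real.norm_of_nonneg (le_of_lt ht)]
  simp

/-- The Laplace transform of `t ^ k`. -/
theorem integral_pow_mul_exp_neg_mul_complex (k : ℕ) {s : ℂ} (hs : 0 < s.re) :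
    ∫ t in Set.Ioi (0:ℝ), (t : ℂ) ^ k * Complex.exp (-(s * t)) = k.factorial / s ^ (k + 1) := by
  have hs0 : s ≠ 0 := by rintro rfl; simp at hs
  induction k with
  | zero =>
    have h := integral_exp_mul_complex_Ioi (a := -s) (by simpa using hs) 0
    simpa using h
  | succ k ih =>
    have hk := (integrableOn_pow_mul_exp_neg_mul_complex k hs).const_mul ((k : ℂ) + 1)
    have hk1 := (integrableOn_pow_mul_exp_neg_mul_complex (k + 1) hs).const_mul s
    have hderiv (t : ℝ) : HasDerivAt (fun t : ℝ => (t : ℂ) ^ (k + 1) * Complex.exp (-(s * t)))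
        (((k : ℂ) + 1) * ((t : ℂ) ^ k * Complex.exp (-(s * t))) -
          s * ((t : ℂ) ^ (k + 1) * Complex.exp (-(s * t)))) t := by
      have h1 := (hasDerivAt_pow (k + 1) (t : ℂ)).mul
        (((hasDerivAt_id (t : ℂ)).const_mul s).neg.cexp)
      convert! h1.comp_ofReal using 1
      simp
      ring
    have hlim := tendsto_zero_of_hasDerivAt_of_integrableOn_Ioi (fun t _ => hderiv t)
      (hk.sub hk1) (integrableOn_pow_mul_exp_neg_mul_complex (k + 1) hs)
    have h := integral_Ioi_of_hasDerivAt_of_tendsto' (fun t _ => hderiv t) (hk.sub hk1) hlim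
    rw [integral_sub hk hk1, integral_const_mul, integral_const_mul, ih] at h
    have h' : s * ∫ t in Set.Ioi (0:ℝ), (t : ℂ) ^ (k + 1) * Complex.exp (-(s * t)) =
        (k + 1) * (k.factorial / s ^ (k + 1)) := by
      simp at h
      linear_combination -h
    apply mul_left_cancel₀ hs0
    rw [h', Nat.factorial_succ]
    push_cast
    field_simp
    ring

/-- The Laplace transform of `t ↦ P(k, λt)`, together with its absolute convergence. -/
theorem laplace_lowP {lam : ℝ} (hlam : 0 < lam) {θ : ℂ} (hθ : 0 < θ.re) (k : ℕ) :
    IntegrableOn (fun t : ℝ => Complex.exp (-θ * t) * (lowP k (lam * t) : ℂ)) (Set.Ioi 0) ∧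
    ∫ t in Set.Ioi (0:ℝ), Complex.exp (-θ * t) * (lowP k (lam * t) : ℂ) =
      1 / θ * (lam / (θ + lam)) ^ k := by
  have hθ0 : θ ≠ 0 := by rintro rfl; simp at hθ
  have hs : 0 < (θ + lam).re := by simp; positivity
  have hs0 : θ + lam ≠ 0 := by intro h; simp [h] at hs
  induction k with
  | zero =>
    constructor
    · simpa [lowP] using integrableOn_pow_mul_exp_neg_mul_complex 0 hθ
    · simpa [lowP] using integral_pow_mul_exp_neg_mul_complex 0 hθ
  | succ k ih =>
    have hrec : (fun t : ℝ => Complex.exp (-θ * t) * (lowP (k + 1) (lam * t) : ℂ)) =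
        fun t : ℝ => Complex.exp (-θ * t) * (lowP k (lam * t) : ℂ) -
          (lam ^ k / k.factorial : ℂ) * ((t : ℂ) ^ k * Complex.exp (-((θ + lam) * t))) := by
      ext t
      have he : Complex.exp (-((θ + lam) * t)) =
          Complex.exp (-θ * t) * Complex.exp (-(lam * t)) := by
        rw [← Complex.exp_add]
        ring_nf
      rw [lowP_succ, he]
      push_cast
      ring
    have hi := (integrableOn_pow_mul_exp_neg_mul_complex k hs).const_mul
      (lam ^ k / k.factorial : ℂ)
    rw [hrec]
    refine ⟨ih.1.sub hi, ?_⟩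
    rw [integral_sub ih.1 hi, ih.2, integral_const_mul,
      integral_pow_mul_exp_neg_mul_complex k hs]
    have hk : (k.factorial : ℂ) ≠ 0 := by exact_mod_cast k.factorial_ne_zero
    rw [div_pow, div_pow]
    field_simp
    ring

/-- For `Re θ > 0` and `j : ℕ`,
`∫₀^∞ e^{−θt} b^{j+1} ∑_{k=0}^j C(j,k)(a/b)^k [P(k,λt) + (μ/λ + a/b)P(k+1,λt)] dt
  = (1/θ)((bθ+bμ+λ)/(θ+λ))((bθ+λ)/(θ+λ))^j` where `b = 1 − a`. -/
theorem stmt18 (a lam μ : ℝ) (ha : 0 < a) (ha1 : a < 1) (hlam : 0 < lam) (hμ : 0 ≤ μ)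
    (θ : ℂ) (hθ : 0 < θ.re) (j : ℕ) :
    ∫ t in Set.Ioi (0:ℝ), Complex.exp (-θ * (t : ℂ)) *
        ((((1 - a) ^ (j + 1) * ∑ k ∈ Finset.range (j + 1), (Nat.choose j k : ℝ) * (a / (1 - a)) ^ k *
          (lowP k (lam * t) + (μ / lam + a / (1 - a)) * lowP (k + 1) (lam * t)) : ℝ)) : ℂ)
      = (1 / θ) * ((((1 - a : ℝ) : ℂ) * θ + ((1 - a : ℝ) : ℂ) * (μ : ℂ) + (lam : ℂ)) / (θ + (lam : ℂ))) *
          ((((1 - a : ℝ) : ℂ) * θ + (lam : ℂ)) / (θ + (lam : ℂ))) ^ j := by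
  have hθ0 : θ ≠ 0 := by rintro rfl; simp at hθ
  have hs0 : θ + lam ≠ 0 := by
    intro h
    have := congrArg Complex.re h
    simp at this
    linarith
  have hb : ((1 - a : ℝ) : ℂ) ≠ 0 := by exact_mod_cast (sub_pos.mpr ha1).ne'
  have hl : (lam : ℂ) ≠ 0 := by exact_mod_cast hlam.ne'
  have hab : (a : ℂ) = 1 - ((1 - a : ℝ) : ℂ) := by push_cast; ring
  set b : ℂ := ((1 - a : ℝ) : ℂ) with hbdef
  set c : ℂ := μ / lam + a / b with hc
  set r : ℂ := lam / (θ + lam) with hr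
  have hL := laplace_lowP hlam hθ
  have hterm (k : ℕ) : IntegrableOn (fun t : ℝ =>
      b ^ (j + 1) * ((j.choose k : ℂ) * (a / b) ^ k) *
        (Complex.exp (-θ * t) * (lowP k (lam * t) : ℂ) +
          c * (Complex.exp (-θ * t) * (lowP (k + 1) (lam * t) : ℂ)))) (Set.Ioi 0) := ((hL k).1.add ((hL (k + 1)).1.const_mul c)).const_mul
    (b ^ (j + 1) * ((j.choose k : ℂ) * (a / b) ^ k))
  calc
    _ = ∫ t in Set.Ioi (0:ℝ), ∑ k ∈ Finset.range (j + 1),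
          b ^ (j + 1) * ((j.choose k : ℂ) * (a / b) ^ k) *
            (Complex.exp (-θ * t) * (lowP k (lam * t) : ℂ) +
              c * (Complex.exp (-θ * t) * (lowP (k + 1) (lam * t) : ℂ))) := by
      congr 1
      ext t
      rw [Complex.ofReal_mul, Complex.ofReal_sum, Complex.ofReal_pow, ← hbdef,
        Finset.mul_sum, Finset.mul_sum]
      refine Finset.sum_congr rfl fun k _ => ?_
      simp only [Complex.ofReal_mul, Complex.ofReal_add, Complex.ofReal_div,
        Complex.ofReal_pow, Complex.ofReal_natCast, ← hbdef, ← hc]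
      ring
    _ = ∑ k ∈ Finset.range (j + 1), b ^ (j + 1) * ((j.choose k : ℂ) * (a / b) ^ k) *
          (1 / θ * r ^ k + c * (1 / θ * r ^ (k + 1))) := by
      rw [integral_finsetSum _ fun k _ => hterm k]
      refine Finset.sum_congr rfl fun k _ => ?_
      rw [integral_const_mul, integral_add (hL k).1 ((hL (k + 1)).1.const_mul c),
        integral_const_mul, (hL k).2, (hL (k + 1)).2]
    _ = 1 / θ * (b * (1 + c * r)) * (b * (a / b * r + 1)) ^ j := by
      rw [mul_pow, add_pow, Finset.mul_sum, Finset.mul_sum]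
      refine Finset.sum_congr rfl fun k _ => ?_
      rw [one_pow, mul_pow]
      ring
    _ = _ := by
      have h1 : b * (1 + c * r) = (b * θ + b * μ + lam) / (θ + lam) := by
        rw [hc, hr, hab]
        field_simp
        ring
      have h2 : b * (a / b * r + 1) = (b * θ + lam) / (θ + lam) := by
        rw [hr, hab]
        field_simp
        ring
      rw [h1, h2]
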